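/- For all sufficiently large N, any 1 ≤ k ≤ (log N)/2, and any gentle mapping f: if Y = (Y_1,…,Y_k) is a uniform random vector in Σ_N^k, then for every z ∈ Σ_N, μ(z ∈ ⋃_{j=1}^k (H(Y_j) \ H(f_j(Y)))) ≤ N^{-1/25}; moreover this probability does not depend on z and equals 2^{-N} E_μ[|⋃_{j=1}^k (H(Y_j) \ H(f_j(Y)))|]. -/

import Mathlib

open scoped Classical

noncomputable section


/-- A point of the discrete cube `Σ_N = {-1,1}^N`, encoded by booleans
(`true ↦ +1`, `false ↦ -1`). -/
abbrev Cube (N : ℕ) := Fin N → Bool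

/-- The `±1` value encoded by a boolean. -/
def pmVal (b : Bool) : ℝ := if b then 1 else -1

/-- The inner product `x · y = ∑ i x^i y^i` on `Σ_N`. -/
def cubeDot {N : ℕ} (x y : Cube N) : ℝ := ∑ i, pmVal (x i) * pmVal (y i)

/-- The half cube `H(x) := {y ∈ Σ_N : x · y ≥ κ √N}`. -/
def halfCube {N : ℕ} (κ : ℝ) (x : Cube N) : Set (Cube N) :=
  {y | cubeDot x y ≥ κ * Real.sqrt N}

/-- The sign-switching action of `g ∈ Σ_N` on `x ∈ Σ_N`: `(g∘x)^i = g^i x^i`.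
In the boolean encoding the product of signs `g^i x^i` is `+1` iff `g^i = x^i`. -/
def signSwitch {N : ℕ} (g : Cube N) (x : Cube N) : Cube N := fun i => g i == x i

/-- A mapping `f = (f_1, …, f_{k+1}) : Σ_N^{k+1} → Σ_N^{k+1}` is gentle (with
constant `C₂`) if it commutes with every sign switch `g ∈ Σ_N` (acting
componentwise) and moves each coordinate vector by Hamming distance at most
`2^{k+1} C₂ (N log N)^{1/2}`. -/
def Gentle {N k : ℕ} (C₂ : ℝ)
    (f : (Fin (k + 1) → Cube N) → (Fin (k + 1) → Cube N)) : Prop :=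
  (∀ g : Cube N, ∀ Y : Fin (k + 1) → Cube N,
      f (fun i => signSwitch g (Y i)) = fun i => signSwitch g (f Y i)) ∧
    ∀ Y : Fin (k + 1) → Cube N, ∀ i : Fin (k + 1),
      (hammingDist (Y i) (f Y i) : ℝ) ≤
        2 ^ (k + 1) * C₂ * Real.sqrt (N * Real.log N)

/-- The probability of an event `E` under the uniform distribution on a finite
type (modelling i.i.d. uniform random vectors). -/
def unifP {α : Type*} [Fintype α] (E : Set α) : ℝ :=
  (E.ncard : ℝ) / (Fintype.card α)


lemma pmVal_beq (a b : Bool) : pmVal (a == b) = pmVal a * pmVal b := by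
  cases a <;> cases b <;> simp [pmVal]

lemma pmVal_sq (a : Bool) : pmVal a * pmVal a = 1 := by
  cases a <;> simp [pmVal]

lemma cubeDot_switch {N : ℕ} (g x z : Cube N) :
    cubeDot (signSwitch g x) z = cubeDot g (signSwitch x z) := by
  unfold cubeDot signSwitch
  refine Finset.sum_congr rfl fun i _ => ?_
  rw [pmVal_beq, pmVal_beq]; ring

lemma cubeDot_switch2 {N : ℕ} (g x z : Cube N) :
    cubeDot (signSwitch g x) (signSwitch g z) = cubeDot x z := by
  unfold cubeDot signSwitch
  refine Finset.sum_congr rfl fun i _ => ?_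
  rw [pmVal_beq, pmVal_beq]
  linear_combination (pmVal (x i) * pmVal (z i)) * pmVal_sq (g i)

lemma signSwitch_invol {N : ℕ} (g x : Cube N) : signSwitch g (signSwitch g x) = x := by
  funext i
  unfold signSwitch
  cases g i <;> cases x i <;> rfl

lemma signSwitch_comm' {N : ℕ} (g x : Cube N) : signSwitch g x = signSwitch x g := by
  funext i
  unfold signSwitch
  cases g i <;> cases x i <;> rfl

lemma second_moment (N : ℕ) (a : Fin N → ℝ) :
    ∑ g : Cube N, (∑ i, pmVal (g i) * a i) ^ 2 = 2 ^ N * ∑ i, a i ^ 2 := by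
  induction N with
  | zero => simp
  | succ n ih =>
    rw [← Equiv.sum_comp (Fin.consEquiv (fun _ : Fin (n+1) => Bool)), Fintype.sum_prod_type,
      Fintype.sum_bool, ← Finset.sum_add_distrib]
    have := ih (fun i => a i.succ)
    have e : ∀ x : Fin n → Bool,
        (∑ i, pmVal ((Fin.consEquiv (fun _ : Fin (n+1) => Bool)) (true, x) i) * a i) ^ 2 +
        (∑ i, pmVal ((Fin.consEquiv (fun _ : Fin (n+1) => Bool)) (false, x) i) * a i) ^ 2
        = 2 * a 0 ^ 2 + 2 * (∑ i, pmVal (x i) * a i.succ) ^ 2 := by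
      intro x
      simp only [Fin.sum_univ_succ, Fin.consEquiv_apply, Fin.cons_zero, Fin.cons_succ]
      simp only [pmVal, if_true, Bool.false_eq_true, if_false]
      ring
    rw [Finset.sum_congr rfl (fun x _ => e x), Finset.sum_add_distrib, ← Finset.mul_sum (f := fun x : Fin n → Bool => (∑ i, pmVal (x i) * a i.succ) ^ 2), this,
      Fin.sum_univ_succ]
    simp
    ring

lemma centralBinom_sq (n : ℕ) : n.centralBinom ^ 2 * (2 * n + 1) ≤ 16 ^ n := by
  induction n with
  | zero => simp
  | succ n ih =>
    have h := Nat.succ_mul_centralBinom_succ n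
    have h1 : ((n + 1) ^ 2) * ((n+1).centralBinom ^ 2 * (2 * (n+1) + 1)) ≤
        (n+1)^2 * 16 ^ (n+1) := by
      calc ((n + 1) ^ 2) * ((n+1).centralBinom ^ 2 * (2 * (n+1) + 1))
          = ((n + 1) * (n+1).centralBinom) ^ 2 * (2 * (n+1) + 1) := by ring
        _ = (n.centralBinom ^ 2 * (2 * n + 1)) * (4 * ((2 * n + 1) * (2 * n + 3))) := by
            rw [h]; ring
        _ ≤ 16 ^ n * (16 * (n+1)^2) := by
            refine Nat.mul_le_mul ih ?_
            nlinarith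
        _ = _ := by ring
    exact Nat.le_of_mul_le_mul_left h1 (by positivity)

lemma choose_sq (N r : ℕ) : (N.choose r) ^ 2 * N ≤ 4 ^ N := by
  rcases Nat.even_or_odd' N with ⟨n, rfl | rfl⟩
  · have h := centralBinom_sq n
    have h2 := Nat.choose_le_centralBinom r n
    calc _ ≤ n.centralBinom ^ 2 * (2 * n + 1) := by gcongr; omega
      _ ≤ 16 ^ n := h
      _ = _ := by rw [pow_mul]; norm_num
  · have h := centralBinom_sq n
    have h3 : (2 * n + 1).choose r ≤ 2 * n.centralBinom := by
      cases r with
      | zero => have := Nat.centralBinom_pos n; simp; omega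
      | succ r =>
        rw [Nat.choose_succ_succ]
        have := Nat.choose_le_centralBinom r n
        have := Nat.choose_le_centralBinom (r+1) n
        simp only [Nat.succ_eq_add_one]
        omega
    calc _ ≤ (2 * n.centralBinom) ^ 2 * (2 * n + 1) := by gcongr
      _ = 4 * (n.centralBinom ^ 2 * (2 * n + 1)) := by ring
      _ ≤ 4 * 16 ^ n := by gcongr
      _ = _ := by rw [pow_succ, pow_mul]; norm_num; ring

lemma choose_le_real (N r : ℕ) (hN : 0 < N) : (N.choose r : ℝ) ≤ 2 ^ N / Real.sqrt N := by
  have hp : (0:ℝ) < N := by exact_mod_cast hN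
  rw [le_div_iff₀ (Real.sqrt_pos.2 hp)]
  refine le_of_sq_le_sq ?_ (by positivity) |>.trans le_rfl
  rw [mul_pow, Real.sq_sqrt hp.le, ← pow_mul, mul_comm N 2, pow_mul]
  have := choose_sq N r
  norm_num
  exact_mod_cast this

/-- agreement set -/
def agr {N : ℕ} (w g : Cube N) : Finset (Fin N) := Finset.univ.filter fun i => g i = w i

lemma cubeDot_agr {N : ℕ} (w g : Cube N) : cubeDot g w = 2 * ((agr w g).card : ℝ) - N := by
  have : ∀ i, pmVal (g i) * pmVal (w i) = 2 * (if g i = w i then (1:ℝ) else 0) - 1 := by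
    intro i
    cases g i <;> cases w i <;> simp [pmVal] <;> norm_num
  unfold cubeDot agr
  simp only [this, Finset.sum_sub_distrib, ← Finset.mul_sum, Finset.sum_boole]
  simp

lemma agr_inj {N : ℕ} (w : Cube N) : Function.Injective (agr w) := by
  intro g h e
  funext i
  have : i ∈ agr w g ↔ i ∈ agr w h := by rw [e]
  simp only [agr, Finset.mem_filter, Finset.mem_univ, true_and] at this
  revert this
  cases g i <;> cases h i <;> cases w i <;> simp

lemma fiber_card {N : ℕ} (w : Cube N) (r : ℕ) :
    (Finset.univ.filter fun g : Cube N => (agr w g).card = r).card ≤ N.choose r := by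
  have := Finset.card_le_card_of_injOn (s := Finset.univ.filter fun g : Cube N => (agr w g).card = r)
    (t := Finset.powersetCard r (Finset.univ : Finset (Fin N))) (agr w)
    (by intro g hg; simpa [Finset.mem_powersetCard] using hg) ((agr_inj w).injOn)
  simpa using this

lemma anti {N : ℕ} (hN : 0 < N) (w : Cube N) (c T : ℝ) (hT : 0 ≤ T) :
    ((Finset.univ.filter fun g : Cube N => c ≤ cubeDot g w ∧ cubeDot g w ≤ c + T).card : ℝ)
      ≤ (T / 2 + 1) * (2 ^ N / Real.sqrt N) := by
  set S := Finset.univ.filter fun g : Cube N => c ≤ cubeDot g w ∧ cubeDot g w ≤ c + T with hS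
  set B := N.choose (N / 2)
  have h1 : S.card ≤ B * (Finset.Icc ⌈(c + N) / 2⌉ ⌊(c + N) / 2 + T / 2⌋).card := by
    refine Finset.card_le_mul_card_image_of_maps_to (f := fun g => ((agr w g).card : ℤ)) ?_ B ?_
    · intro g hg
      rw [hS, Finset.mem_filter, cubeDot_agr] at hg
      rw [Finset.mem_Icc, Int.ceil_le, Int.le_floor]
      push_cast
      constructor <;> linarith [hg.2.1, hg.2.2]
    · intro b _
      rcases le_or_gt 0 b with hb | hb
      · lift b to ℕ using hb
        refine le_trans ?_ ((fiber_card w b).trans (Nat.choose_le_middle b N))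
        refine Finset.card_le_card fun g hg => ?_
        simp only [Finset.mem_filter, Finset.mem_univ, true_and] at hg ⊢
        exact_mod_cast hg.2
      · rw [Finset.card_eq_zero.2]
        · exact Nat.zero_le _
        · refine Finset.filter_eq_empty_iff.2 fun g _ h => ?_
          omega
  have h2 : ((Finset.Icc ⌈(c + N) / 2⌉ ⌊(c + N) / 2 + T / 2⌋).card : ℝ) ≤ T / 2 + 1 := by
    rw [Int.card_Icc]
    have a1 := Int.le_ceil ((c + N) / 2)
    have a2 := Int.floor_le ((c + N) / 2 + T / 2)
    rcases le_or_gt 0 (⌊(c + N) / 2 + T / 2⌋ + 1 - ⌈(c + N) / 2⌉) with h | h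
    · have : (((⌊(c + N) / 2 + T / 2⌋ + 1 - ⌈(c + N) / 2⌉).toNat : ℤ) : ℝ) =
        ((⌊(c + N) / 2 + T / 2⌋ + 1 - ⌈(c + N) / 2⌉ : ℤ) : ℝ) := by rw [Int.toNat_of_nonneg h]
      rw [Int.cast_natCast] at this
      rw [this]
      push_cast
      linarith
    · rw [Int.toNat_of_nonpos h.le]
      simp; linarith
  calc (S.card : ℝ) ≤ B * ((Finset.Icc ⌈(c + N) / 2⌉ ⌊(c + N) / 2 + T / 2⌋).card : ℝ) := by
        exact_mod_cast h1
    _ ≤ (2 ^ N / Real.sqrt N) * (T / 2 + 1) := by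
        gcongr
        exact choose_le_real N _ hN
    _ = _ := mul_comm _ _

lemma core {N : ℕ} (hN : 0 < N) (w v : Cube N) (c T s : ℝ) (hT : 0 < T)
    (hs : (hammingDist w v : ℝ) ≤ s) :
    ((Finset.univ.filter fun g : Cube N => c ≤ cubeDot g w ∧ cubeDot g v < c).card : ℝ)
      ≤ ((T / 2 + 1) / Real.sqrt N + 4 * s / T ^ 2) * 2 ^ N := by
  set B := Finset.univ.filter fun g : Cube N => T < cubeDot g w - cubeDot g v with hB
  have hsub : (Finset.univ.filter fun g : Cube N => c ≤ cubeDot g w ∧ cubeDot g v < c) ⊆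
      (Finset.univ.filter fun g : Cube N => c ≤ cubeDot g w ∧ cubeDot g w ≤ c + T) ∪ B := by
    intro g hg
    simp only [hB, Finset.mem_union, Finset.mem_filter, Finset.mem_univ, true_and] at hg ⊢
    by_cases h : cubeDot g w ≤ c + T
    · exact Or.inl ⟨hg.1, h⟩
    · right; linarith [hg.2]
  have hd : ∀ g : Cube N, cubeDot g w - cubeDot g v =
      ∑ i, pmVal (g i) * (pmVal (w i) - pmVal (v i)) := by
    intro g
    simp only [cubeDot, mul_sub, Finset.sum_sub_distrib]
  have hsum : ∑ i, (pmVal (w i) - pmVal (v i)) ^ 2 = 4 * (hammingDist w v : ℝ) := by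
    have : ∀ i, (pmVal (w i) - pmVal (v i)) ^ 2 = 4 * (if w i ≠ v i then (1:ℝ) else 0) := by
      intro i
      cases w i <;> cases v i <;> simp [pmVal] <;> norm_num
    simp only [this, ← Finset.mul_sum, Finset.sum_boole, hammingDist]
  have hBc : (B.card : ℝ) * T ^ 2 ≤ 2 ^ N * (4 * s) := by
    calc (B.card : ℝ) * T ^ 2 = ∑ g ∈ B, T ^ 2 := by simp
      _ ≤ ∑ g ∈ B, (cubeDot g w - cubeDot g v) ^ 2 := by
          refine Finset.sum_le_sum fun g hg => ?_
          rw [hB, Finset.mem_filter] at hg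
          have := hg.2
          gcongr
      _ ≤ ∑ g, (cubeDot g w - cubeDot g v) ^ 2 :=
          Finset.sum_le_sum_of_subset_of_nonneg (Finset.subset_univ _) fun _ _ _ => sq_nonneg _
      _ = 2 ^ N * (4 * (hammingDist w v : ℝ)) := by
          simp only [hd]
          rw [second_moment, hsum]
      _ ≤ _ := by gcongr
  have hB2 : (B.card : ℝ) ≤ 2 ^ N * (4 * s) / T ^ 2 := by
    rwa [le_div_iff₀ (by positivity)]
  have h3 := anti hN w c T hT.le
  have h4 : ((Finset.univ.filter fun g : Cube N => c ≤ cubeDot g w ∧ cubeDot g v < c).card : ℝ) ≤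
      ((Finset.univ.filter fun g : Cube N => c ≤ cubeDot g w ∧ cubeDot g w ≤ c + T).card : ℝ)
        + B.card := by
    exact_mod_cast (Finset.card_le_card hsub).trans (Finset.card_union_le _ _)
  calc _ ≤ _ := h4
    _ ≤ (T / 2 + 1) * (2 ^ N / Real.sqrt N) + 2 ^ N * (4 * s) / T ^ 2 := add_le_add h3 hB2
    _ = _ := by ring

lemma hamming_switch {N : ℕ} (x y z : Cube N) :
    hammingDist (signSwitch x z) (signSwitch y z) = hammingDist x y := by
  unfold hammingDist signSwitch
  congr 1
  ext i
  simp only [Finset.mem_filter, Finset.mem_univ, true_and]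
  cases x i <;> cases y i <;> cases z i <;> simp

/-- componentwise sign switch as an equivalence -/
def actE {N k : ℕ} (g : Cube N) : (Fin (k + 1) → Cube N) ≃ (Fin (k + 1) → Cube N) :=
  Function.Involutive.toPerm (fun Y i => signSwitch g (Y i))
    (fun Y => funext fun i => signSwitch_invol g (Y i))

lemma actE_apply {N k : ℕ} (g : Cube N) (Y : Fin (k + 1) → Cube N) :
    actE g Y = fun i => signSwitch g (Y i) := rfl

lemma count_equiv {α : Type*} [Fintype α] (e : α ≃ α) (P : α → Prop) [DecidablePred P] :
    (Finset.univ.filter fun a => P (e a)).card = (Finset.univ.filter P).card := by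
  rw [← Fintype.card_subtype, ← Fintype.card_subtype]
  exact Fintype.card_congr (e.subtypeEquiv fun _ => Iff.rfl)

lemma count_orbit {N k : ℕ} (P : (Fin (k + 1) → Cube N) → Prop) [DecidablePred P] (M : ℝ)
    (h : ∀ Y, ((Finset.univ.filter fun g : Cube N => P (actE g Y)).card : ℝ) ≤ M * 2 ^ N) :
    ((Finset.univ.filter P).card : ℝ) ≤ M * Fintype.card (Fin (k + 1) → Cube N) := by
  have h1 : ∑ g : Cube N, ((Finset.univ.filter fun Y => P (actE g Y)).card : ℝ)
      = 2 ^ N * ((Finset.univ.filter P).card : ℝ) := by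
    simp only [count_equiv]
    simp
  have h2 : ∑ g : Cube N, ((Finset.univ.filter fun Y => P (actE g Y)).card : ℝ)
      = ∑ Y, ((Finset.univ.filter fun g : Cube N => P (actE g Y)).card : ℝ) := by
    simp only [← Finset.sum_boole]
    exact Finset.sum_comm
  have h3 : ∑ Y : Fin (k + 1) → Cube N, ((Finset.univ.filter fun g : Cube N => P (actE g Y)).card : ℝ)
      ≤ ∑ Y : Fin (k + 1) → Cube N, M * 2 ^ N := Finset.sum_le_sum fun Y _ => h Y
  rw [← h2, h1, Finset.sum_const, Finset.card_univ, nsmul_eq_mul] at h3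
  have : (0:ℝ) < 2 ^ N := by positivity
  refine le_of_mul_le_mul_left (h3.trans (le_of_eq ?_)) this
  ring

lemma count_j {N k : ℕ} (hN : 0 < N) (κ C₂ T : ℝ) (hT : 0 < T)
    (f : (Fin (k + 1) → Cube N) → (Fin (k + 1) → Cube N)) (hf : Gentle C₂ f) (z : Cube N)
    (j : Fin (k + 1)) :
    ((Finset.univ.filter fun Y => z ∈ halfCube κ (Y j) \ halfCube κ (f Y j)).card : ℝ) ≤
      ((T / 2 + 1) / Real.sqrt N + 4 * (2 ^ (k + 1) * C₂ * Real.sqrt (N * Real.log N)) / T ^ 2) *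
        Fintype.card (Fin (k + 1) → Cube N) := by
  refine count_orbit (fun Y => z ∈ halfCube κ (Y j) \ halfCube κ (f Y j)) _ fun Y => ?_
  have := core hN (signSwitch (Y j) z) (signSwitch (f Y j) z) (κ * Real.sqrt N) T
    (2 ^ (k + 1) * C₂ * Real.sqrt (N * Real.log N)) hT
    (by rw [hamming_switch]; exact hf.2 Y j)
  refine le_trans ?_ this
  rw [Nat.cast_le]
  refine Finset.card_le_card fun g => ?_
  simp only [Finset.mem_filter, Finset.mem_univ, true_and, actE_apply, hf.1, halfCube,
    Set.mem_sdiff, Set.mem_ofPred_eq, cubeDot_switch, ge_iff_le, not_le, imp_self]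

lemma unifP_eq {α : Type*} [Fintype α] (E : α → Prop) :
    unifP {a | E a} = ((Finset.univ.filter E).card : ℝ) / Fintype.card α := by
  unfold unifP
  congr 2
  rw [Set.ncard_eq_toFinset_card']
  congr 1
  ext; simp

lemma union_bound {N k : ℕ} (hN : 0 < N) (κ C₂ T : ℝ) (hT : 0 < T)
    (f : (Fin (k + 1) → Cube N) → (Fin (k + 1) → Cube N)) (hf : Gentle C₂ f) (z : Cube N) :
    unifP {Y : Fin (k + 1) → Cube N |
      z ∈ ⋃ j : Fin (k + 1), (halfCube κ (Y j) \ halfCube κ (f Y j))} ≤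
      ((k : ℝ) + 1) * ((T / 2 + 1) / Real.sqrt N +
        4 * (2 ^ (k + 1) * C₂ * Real.sqrt (N * Real.log N)) / T ^ 2) := by
  rw [unifP_eq, div_le_iff₀ (by exact_mod_cast Fintype.card_pos)]
  have h1 : (Finset.univ.filter fun Y : Fin (k + 1) → Cube N =>
      z ∈ ⋃ j : Fin (k + 1), (halfCube κ (Y j) \ halfCube κ (f Y j))) ⊆
      Finset.univ.biUnion fun j : Fin (k + 1) =>
        Finset.univ.filter fun Y => z ∈ halfCube κ (Y j) \ halfCube κ (f Y j) := by
    intro Y hY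
    simpa only [Finset.mem_biUnion, Finset.mem_filter, Finset.mem_univ, true_and,
      Set.mem_iUnion] using hY
  have h2 := (Finset.card_le_card h1).trans Finset.card_biUnion_le
  have h3 : ((Finset.univ.filter fun Y : Fin (k + 1) → Cube N =>
      z ∈ ⋃ j : Fin (k + 1), (halfCube κ (Y j) \ halfCube κ (f Y j))).card : ℝ) ≤
      ∑ j : Fin (k + 1),
        ((Finset.univ.filter fun Y => z ∈ halfCube κ (Y j) \ halfCube κ (f Y j)).card : ℝ) := by
    exact_mod_cast h2
  refine (h3.trans (Finset.sum_le_sum fun j _ => count_j hN κ C₂ T hT f hf z j)).trans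
    (le_of_eq ?_)
  rw [Finset.sum_const, Finset.card_univ, Fintype.card_fin, nsmul_eq_mul]
  push_cast
  ring

lemma mem_switch {N k : ℕ} (κ C₂ : ℝ)
    (f : (Fin (k + 1) → Cube N) → (Fin (k + 1) → Cube N)) (hf : Gentle C₂ f) (g z : Cube N)
    (Y : Fin (k + 1) → Cube N) :
    (signSwitch g z ∈ ⋃ j : Fin (k + 1), (halfCube κ (actE g Y j) \ halfCube κ (f (actE g Y) j)))
      ↔ z ∈ ⋃ j : Fin (k + 1), (halfCube κ (Y j) \ halfCube κ (f Y j)) := by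
  simp only [Set.mem_iUnion, Set.mem_sdiff, halfCube, Set.mem_ofPred_eq, actE_apply, hf.1,
    cubeDot_switch2]

lemma second_part {N k : ℕ} (κ C₂ : ℝ)
    (f : (Fin (k + 1) → Cube N) → (Fin (k + 1) → Cube N)) (hf : Gentle C₂ f) (z : Cube N) :
    unifP {Y : Fin (k + 1) → Cube N |
        z ∈ ⋃ j : Fin (k + 1), (halfCube κ (Y j) \ halfCube κ (f Y j))} =
      (2 : ℝ) ^ (-(N : ℝ)) *
        ((∑ Y : Fin (k + 1) → Cube N,
            (((⋃ j : Fin (k + 1),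
                (halfCube κ (Y j) \ halfCube κ (f Y j))).ncard : ℝ))) /
          (Fintype.card (Fin (k + 1) → Cube N))) := by
  rw [unifP_eq]
  set U : (Fin (k + 1) → Cube N) → Set (Cube N) :=
    fun Y => ⋃ j : Fin (k + 1), (halfCube κ (Y j) \ halfCube κ (f Y j)) with hU
  have hinv : ∀ w : Cube N, (Finset.univ.filter fun Y => w ∈ U Y).card =
      (Finset.univ.filter fun Y => z ∈ U Y).card := by
    intro w
    rw [← count_equiv (actE (signSwitch w z)) (fun Y => w ∈ U Y)]
    congr 1
    ext Y
    simp only [Finset.mem_filter, Finset.mem_univ, true_and]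
    have e : signSwitch (signSwitch w z) z = w := by
      rw [signSwitch_comm', signSwitch_comm' w z, signSwitch_invol]
    have := mem_switch κ C₂ f hf (signSwitch w z) z Y
    rw [e] at this
    exact this
  have hsum : ∑ Y : Fin (k + 1) → Cube N, ((U Y).ncard : ℝ) =
      2 ^ N * ((Finset.univ.filter fun Y => z ∈ U Y).card : ℝ) := by
    have a : ∀ Y, ((U Y).ncard : ℝ) = ∑ w : Cube N, if w ∈ U Y then (1:ℝ) else 0 := by
      intro Y
      rw [Finset.sum_boole, Set.ncard_eq_toFinset_card']
      congr 2
      ext; simp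
    simp only [a]
    rw [Finset.sum_comm]
    simp only [Finset.sum_boole, hinv]
    simp
  show _ = (2 : ℝ) ^ (-(N : ℝ)) * ((∑ Y, ((U Y).ncard : ℝ)) / _)
  rw [hsum, Real.rpow_neg (by norm_num), Real.rpow_natCast]
  have : (2:ℝ) ^ N ≠ 0 := by positivity
  field_simp
  rfl

lemma asymp (C : ℝ) : ∀ᶠ N : ℕ in Filter.atTop, (1 + 2 * C) * Real.log N ^ 2 ≤ (N : ℝ) ^ (0.01 : ℝ) := by
  have h := (isLittleO_log_rpow_rpow_atTop 2 (show (0:ℝ) < 0.01 by norm_num)).const_mul_left (1 + 2 * C)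
  have h2 := (h.bound (show (0:ℝ) < 1 by norm_num)).natCast_atTop
  filter_upwards [h2] with N hN
  rw [one_mul] at hN
  have := (le_abs_self _).trans hN
  rw [Real.norm_of_nonneg (by positivity)] at this
  exact_mod_cast this

lemma final_bound (C₂ : ℝ) (hC : 0 < C₂) (N k : ℕ) (hk : (k : ℝ) + 1 ≤ Real.log N / 2)
    (h : (1 + 2 * C₂) * Real.log N ^ 2 ≤ (N : ℝ) ^ (0.01 : ℝ)) :
    ((k : ℝ) + 1) * ((((N : ℝ) ^ (0.45 : ℝ)) / 2 + 1) / Real.sqrt N +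
        4 * (2 ^ (k + 1) * C₂ * Real.sqrt (N * Real.log N)) / ((N : ℝ) ^ (0.45 : ℝ)) ^ 2) ≤
      (N : ℝ) ^ (-(1 : ℝ) / 25) := by
  set L := Real.log N with hL
  have hL1 : 2 ≤ L := by have : (0:ℝ) ≤ k := by positivity
                         linarith
  have hNpos : (0:ℝ) < N := by
    rcases Nat.eq_zero_or_pos N with h0 | h0
    · rw [h0] at hL; simp at hL; linarith
    · exact_mod_cast h0
  have hN1 : (1:ℝ) ≤ N := by exact_mod_cast (by exact_mod_cast hNpos : 0 < N)
  have hT1 : (1:ℝ) ≤ (N:ℝ) ^ (0.45:ℝ) := Real.one_le_rpow hN1 (by norm_num)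
  have h2k : (2:ℝ) ^ (k + 1) ≤ (N:ℝ) ^ (0.35:ℝ) := by
    rw [← Real.rpow_natCast, Real.rpow_def_of_pos (by norm_num), Real.rpow_def_of_pos hNpos]
    apply Real.exp_le_exp.2
    push_cast
    have := Real.log_two_lt_d9
    have := Real.log_pos (show (1:ℝ) < 2 by norm_num)
    rw [← hL]
    nlinarith
  have hsq : Real.sqrt (N * L) ≤ (N:ℝ) ^ (0.5:ℝ) * L := by
    rw [Real.sqrt_mul hNpos.le, Real.sqrt_eq_rpow (N:ℝ)]
    have : Real.sqrt L ≤ L := Real.sqrt_le_iff.2 ⟨by linarith, by nlinarith⟩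
    rw [show (1/2:ℝ) = 0.5 by norm_num]
    exact mul_le_mul_of_nonneg_left this (by positivity)
  have hm0 : (0:ℝ) ≤ (k:ℝ) + 1 := by positivity
  have hA : (((N : ℝ) ^ (0.45 : ℝ)) / 2 + 1) / Real.sqrt N ≤ 2 * (N:ℝ) ^ (-0.05 : ℝ) := by
    rw [Real.sqrt_eq_rpow, div_le_iff₀ (by positivity), mul_assoc, ← Real.rpow_add hNpos]
    norm_num at hT1 ⊢
    linarith
  have hB : 4 * (2 ^ (k + 1) * C₂ * Real.sqrt (N * L)) / ((N : ℝ) ^ (0.45 : ℝ)) ^ 2 ≤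
      4 * C₂ * L * (N:ℝ) ^ (-0.05 : ℝ) := by
    rw [div_le_iff₀ (by positivity), ← Real.rpow_natCast ((N:ℝ) ^ (0.45:ℝ)), ← Real.rpow_mul hNpos.le, mul_assoc _ ((N:ℝ) ^ (-0.05:ℝ)),
      ← Real.rpow_add hNpos]
    calc 4 * (2 ^ (k + 1) * C₂ * Real.sqrt (N * L))
        ≤ 4 * ((N:ℝ) ^ (0.35:ℝ) * C₂ * ((N:ℝ) ^ (0.5:ℝ) * L)) := by gcongr
      _ = 4 * C₂ * L * ((N:ℝ) ^ (0.35:ℝ) * (N:ℝ) ^ (0.5:ℝ)) := by ring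
      _ = 4 * C₂ * L * (N:ℝ) ^ (0.35 + 0.5:ℝ) := by rw [Real.rpow_add hNpos]
      _ ≤ _ := by
        apply le_of_eq
        norm_num
  calc _ ≤ L / 2 * (2 * (N:ℝ) ^ (-0.05 : ℝ) + 4 * C₂ * L * (N:ℝ) ^ (-0.05 : ℝ)) := by
        gcongr
    _ = (L + 2 * C₂ * L ^ 2) * (N:ℝ) ^ (-0.05 : ℝ) := by ring
    _ ≤ ((1 + 2 * C₂) * L ^ 2) * (N:ℝ) ^ (-0.05 : ℝ) := by
        gcongr
        nlinarith
    _ ≤ (N : ℝ) ^ (0.01 : ℝ) * (N:ℝ) ^ (-0.05 : ℝ) := by gcongr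
    _ = _ := by
        rw [← Real.rpow_add hNpos]; norm_num

/-- For every `κ` and constant `C₂ > 0`, for all sufficiently large `N`, any
number of vectors `k + 1 ≤ (log N)/2` and any gentle mapping `f`: if
`Y = (Y_1, …, Y_{k+1})` is uniform in `Σ_N^{k+1}`, then for every `z ∈ Σ_N`
the probability `μ(z ∈ ⋃_j (H(Y_j) \ H(f_j(Y))))` is at most `N^{-1/25}`;
moreover this probability does not depend on `z` as it equals
`2^{-N} E_μ[|⋃_j (H(Y_j) \ H(f_j(Y)))|]`. -/
theorem union_diff_prob_bound (κ : ℝ) (C₂ : ℝ) (hC₂ : 0 < C₂) :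
    ∃ N₀ : ℕ, ∀ N : ℕ, N₀ ≤ N →
      ∀ k : ℕ, ((k : ℝ) + 1) ≤ Real.log N / 2 →
        ∀ f : (Fin (k + 1) → Cube N) → (Fin (k + 1) → Cube N), Gentle C₂ f →
          ∀ z : Cube N,
            unifP {Y : Fin (k + 1) → Cube N |
                z ∈ ⋃ j : Fin (k + 1), (halfCube κ (Y j) \ halfCube κ (f Y j))} ≤
              (N : ℝ) ^ (-(1 : ℝ) / 25) ∧
            unifP {Y : Fin (k + 1) → Cube N |
                z ∈ ⋃ j : Fin (k + 1), (halfCube κ (Y j) \ halfCube κ (f Y j))} =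
              (2 : ℝ) ^ (-(N : ℝ)) *
                ((∑ Y : Fin (k + 1) → Cube N,
                    (((⋃ j : Fin (k + 1),
                        (halfCube κ (Y j) \ halfCube κ (f Y j))).ncard : ℝ))) /
                  (Fintype.card (Fin (k + 1) → Cube N))) := by
  obtain ⟨N₀, h₀⟩ := Filter.eventually_atTop.1 (asymp C₂)
  refine ⟨max N₀ 1, fun N hN k hk f hf z => ⟨?_, second_part κ C₂ f hf z⟩⟩
  have hN1 : 0 < N := lt_of_lt_of_le one_pos ((le_max_right _ _).trans hN)
  have hNp : (0:ℝ) < N := by exact_mod_cast hN1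
  exact (union_bound hN1 κ C₂ ((N : ℝ) ^ (0.45 : ℝ)) (by positivity) f hf z).trans
    (final_bound C₂ hC₂ N k hk (h₀ N ((le_max_left _ _).trans hN)))
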